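/- Let d ≥ 2 and n be positive integers, t ∈ {1, d−1}, and n ≡ t (mod d). Then, in the fraction field ℚ(a,b,c,q), Σ_{k=0}^{(tn-1)/d} ((aq;q^d)_k (q/a;q^d)_k (q/b;q^d)_k / ((q^d;q^d)_k (c;q^d)_k (q^{d+3}/(bc);q^d)_k)) q^{dk} ≡ ((c/(aq);q^d)_{(tn-1)/d} (ac/q;q^d)_{(tn-1)/d}) / ((c;q^d)_{(tn-1)/d} (c/q^2;q^d)_{(tn-1)/d}) modulo (b−q^{tn}). -/

import Mathlib

open Finset

/-- The `q`-shifted factorial `(x; q)_k = (1-x)(1-xq)⋯(1-xq^{k-1})`. -/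
noncomputable def qPoch {K : Type*} [CommRing K] (x q : K) (k : ℕ) : K :=
  ∏ i ∈ Finset.range k, (1 - x * q ^ i)

/-- The polynomial ring `ℚ[a,b,c,q]` in four independent indeterminates. -/
abbrev R4 : Type := MvPolynomial (Fin 4) ℚ

/-- The fraction field `ℚ(a,b,c,q)`. -/
abbrev K4 : Type := FractionRing R4

/-- Congruence in `ℚ(a,b,c,q)` modulo a polynomial `P ∈ ℚ[a,b,c,q]`: `A ≡ B (mod P)`
means `A - B = P * r / s` with `s` a nonzero polynomial coprime to `P`. -/
def congrK4 (A B : K4) (P : R4) : Prop :=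
  ∃ r s : R4, s ≠ 0 ∧ IsRelPrime s P ∧
    A - B = algebraMap R4 K4 (P * r) / algebraMap R4 K4 s

noncomputable def aK : K4 := algebraMap R4 K4 (MvPolynomial.X 0)
noncomputable def bK : K4 := algebraMap R4 K4 (MvPolynomial.X 1)
noncomputable def cK : K4 := algebraMap R4 K4 (MvPolynomial.X 2)
noncomputable def qK : K4 := algebraMap R4 K4 (MvPolynomial.X 3)

section QPochhammer

theorem qPoch_zero {K : Type*} [CommRing K] (x q : K) : qPoch x q 0 = 1 := by
  simp [qPoch]

theorem qPoch_succ {K : Type*} [CommRing K] (x q : K) (k : ℕ) :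
    qPoch x q (k + 1) = qPoch x q k * (1 - x * q ^ k) := by
  simp [qPoch, Finset.prod_range_succ]

variable {K : Type*} [Field K]

theorem qPoch_ne_zero {x q : K} (h : ∀ i, 1 - x * q ^ i ≠ 0) (k : ℕ) : qPoch x q k ≠ 0 :=
  Finset.prod_ne_zero_iff.mpr fun i _ => h i

/-- Reversing the order of the factors in a quotient of two `q`-shifted factorials. -/
theorem qPoch_reflect {Q D x y : K} {N : ℕ} (hx : x * Q ^ N = 1) (hy : y * D = x * Q)
    (hQ : ∀ i, 1 - Q * Q ^ i ≠ 0) (hD : ∀ i, 1 - D * Q ^ i ≠ 0) (k m : ℕ) (hN : k + m = N) :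
    qPoch x Q k * Q ^ k * (qPoch Q Q m * qPoch D Q N) =
      qPoch y Q k * D ^ k * (qPoch D Q m * qPoch Q Q N) := by
  induction k generalizing m with
  | zero =>
    obtain rfl : m = N := by omega
    simp only [qPoch_zero]
    ring
  | succ k ih =>
    have h := ih (m + 1) (by omega)
    have hxk : x * Q ^ k * Q ^ (m + 1) = 1 := by
      rw [← hx, ← hN]
      ring
    have key : (1 - x * Q ^ k) * Q * (1 - D * Q ^ m) =
        (1 - y * Q ^ k) * D * (1 - Q * Q ^ m) := by
      linear_combination (D - Q) * hxk + (Q ^ k - Q ^ k * Q ^ (m + 1)) * hy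
    rw [qPoch_succ, qPoch_succ] at h
    rw [qPoch_succ, qPoch_succ]
    apply mul_right_cancel₀ (mul_ne_zero (hQ m) (hD m))
    linear_combination (1 - x * Q ^ k) * Q * (1 - D * Q ^ m) * h +
      qPoch y Q k * D ^ k * qPoch D Q m * (1 - D * Q ^ m) * qPoch Q Q N * key

/-- The summand of the symmetric form of the `q`-Pfaff–Saalschütz sum. -/
noncomputable def saalTerm (A B D Q : K) (k m : ℕ) : K :=
  qPoch A Q k * qPoch B Q k * D ^ k * qPoch D Q m /
    (qPoch Q Q k * qPoch (A * B * D) Q k * qPoch Q Q m)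

theorem saalTerm_succ_left {A B D Q : K} (hQ : ∀ i, 1 - Q * Q ^ i ≠ 0)
    (hC : ∀ i, 1 - A * B * D * Q ^ i ≠ 0) (k m : ℕ) :
    saalTerm A B D Q (k + 1) m * ((1 - Q * Q ^ k) * (1 - A * B * D * Q ^ k)) =
      saalTerm A B D Q k m * ((1 - A * Q ^ k) * (1 - B * Q ^ k) * D) := by
  have hu := hQ k
  have hv := hC k
  simp only [saalTerm, qPoch_succ]
  generalize 1 - Q * Q ^ k = u at *
  generalize 1 - A * B * D * Q ^ k = v at *
  field_simp
  ring

theorem saalTerm_succ_right {A B D Q : K} (hQ : ∀ i, 1 - Q * Q ^ i ≠ 0) (k m : ℕ) :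
    saalTerm A B D Q k (m + 1) * (1 - Q * Q ^ m) =
      saalTerm A B D Q k m * (1 - D * Q ^ m) := by
  have hu := hQ m
  simp only [saalTerm, qPoch_succ]
  generalize 1 - Q * Q ^ m = u at *
  field_simp

theorem sum_saalTerm_telescope {A B D Q : K} (hQ : ∀ i, 1 - Q * Q ^ i ≠ 0)
    (hC : ∀ i, 1 - A * B * D * Q ^ i ≠ 0) {N : ℕ} (k m : ℕ) (hN : k + m = N) :
    ∑ j ∈ range (k + 1),
      ((1 - A * B * D * Q ^ N) * (1 - Q * Q ^ N) * saalTerm A B D Q j (N + 1 - j) -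
        (1 - A * D * Q ^ N) * (1 - B * D * Q ^ N) * saalTerm A B D Q j (N - j)) =
      -(Q ^ m * (1 - A * Q ^ k) * (1 - B * Q ^ k) * D * saalTerm A B D Q k m) := by
  induction k generalizing m with
  | zero =>
    obtain rfl : m = N := by omega
    simp only [zero_add, sum_range_one, Nat.sub_zero]
    linear_combination (1 - A * B * D * Q ^ m) * saalTerm_succ_right (A := A) (B := B) hQ 0 m
  | succ k ih =>
    rw [sum_range_succ, ih (m + 1) (by omega)]
    obtain rfl : N = k + 1 + m := hN.symm
    rw [show k + 1 + m + 1 - (k + 1) = m + 1 by omega, Nat.add_sub_cancel_left]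
    apply mul_right_cancel₀ (hQ m)
    linear_combination ((1 - A * B * D * Q ^ (k + 1 + m)) * (1 - Q * Q ^ (k + 1 + m)) -
        Q ^ (m + 1) * (1 - Q * Q ^ k) * (1 - A * B * D * Q ^ k)) *
          saalTerm_succ_right (A := A) (B := B) hQ (k + 1) m +
      Q ^ (m + 1) * (1 - Q * Q ^ m) * saalTerm_succ_left hQ hC k (m + 1)

theorem sum_saalTerm {A B D Q : K} (hQ : ∀ i, 1 - Q * Q ^ i ≠ 0)
    (hC : ∀ i, 1 - A * B * D * Q ^ i ≠ 0) (N : ℕ) :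
    ∑ k ∈ range (N + 1), saalTerm A B D Q k (N - k) =
      qPoch (A * D) Q N * qPoch (B * D) Q N / (qPoch (A * B * D) Q N * qPoch Q Q N) := by
  have hQ' := qPoch_ne_zero hQ
  have hC' := qPoch_ne_zero hC
  induction N with
  | zero => simp [saalTerm, qPoch_zero]
  | succ N ih =>
    have h := sum_saalTerm_telescope hQ hC N 0 (add_zero N)
    rw [sum_sub_distrib, ← mul_sum, ← mul_sum, ih] at h
    rw [sum_range_succ, Nat.sub_self]
    have hv := hC N
    have hu := hQ N
    apply mul_left_cancel₀ (mul_ne_zero hv hu)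
    rw [mul_add, eq_add_of_sub_eq h]
    have hlast := saalTerm_succ_left hQ hC N 0
    trans (1 - A * D * Q ^ N) * (1 - B * D * Q ^ N) *
      (qPoch (A * D) Q N * qPoch (B * D) Q N / (qPoch (A * B * D) Q N * qPoch Q Q N))
    · linear_combination hlast
    · have := hQ' N
      have := hC' N
      simp only [qPoch_succ]
      generalize 1 - Q * Q ^ N = u at *
      generalize 1 - A * B * D * Q ^ N = v at *
      field_simp

/-- The `q`-Pfaff–Saalschütz summation. -/
theorem qPfaffSaalschutz {A B D Q x y : K} (hQ : ∀ i, 1 - Q * Q ^ i ≠ 0)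
    (hC : ∀ i, 1 - A * B * D * Q ^ i ≠ 0) (hD : ∀ i, 1 - D * Q ^ i ≠ 0)
    (hY : ∀ i, 1 - y * Q ^ i ≠ 0) {N : ℕ} (hx : x * Q ^ N = 1) (hy : y * D = x * Q) :
    ∑ k ∈ range (N + 1), qPoch A Q k * qPoch B Q k * qPoch x Q k /
        (qPoch Q Q k * qPoch (A * B * D) Q k * qPoch y Q k) * Q ^ k =
      qPoch (B * D) Q N * qPoch (A * D) Q N / (qPoch (A * B * D) Q N * qPoch D Q N) := by
  have hQ' := qPoch_ne_zero hQ
  have hC' := qPoch_ne_zero hC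
  have hD' := qPoch_ne_zero hD
  have hY' := qPoch_ne_zero hY
  have hterm : ∀ k ∈ range (N + 1), qPoch A Q k * qPoch B Q k * qPoch x Q k /
        (qPoch Q Q k * qPoch (A * B * D) Q k * qPoch y Q k) * Q ^ k =
      qPoch Q Q N / qPoch D Q N * saalTerm A B D Q k (N - k) := by
    intro k hk
    have h := qPoch_reflect hx hy hQ hD k (N - k) (by rw [mem_range] at hk; omega)
    have := hQ' k
    have := hQ' (N - k)
    have := hC' k
    have := hD' N
    have := hY' k
    rw [saalTerm, div_mul_div_comm, div_mul_eq_mul_div,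
      div_eq_div_iff (by simp [*]) (by simp [*])]
    linear_combination qPoch A Q k * qPoch B Q k * qPoch Q Q k * qPoch (A * B * D) Q k * h
  rw [sum_congr rfl hterm, ← mul_sum, sum_saalTerm hQ hC]
  have := hQ' N
  have := hC' N
  have := hD' N
  field_simp

end QPochhammer

section Specialization

variable {R K L : Type*} [CommRing R] [Field K] [Field L] [Algebra R K]

/-- `x` is a fraction `r / s` whose denominator does not vanish under `φ`, and `y` is the value
`φ r / φ s`. -/
def SpecializesTo (φ : R →+* L) (x : K) (y : L) : Prop :=
  ∃ r s : R, φ s ≠ 0 ∧ x * algebraMap R K s = algebraMap R K r ∧ y * φ s = φ r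

namespace SpecializesTo

variable {φ : R →+* L} {x x' : K} {y y' : L}

theorem algebraMap (r : R) : SpecializesTo φ (algebraMap R K r) (φ r) :=
  ⟨r, 1, by simp, by simp, by simp⟩

theorem one : SpecializesTo φ (1 : K) (1 : L) := by
  simpa using algebraMap (K := K) (φ := φ) 1

theorem zero : SpecializesTo φ (0 : K) (0 : L) := by
  simpa using algebraMap (K := K) (φ := φ) 0

theorem add (h : SpecializesTo φ x y) (h' : SpecializesTo φ x' y') :
    SpecializesTo φ (x + x') (y + y') := by
  obtain ⟨r, s, hs, h₁, h₂⟩ := h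
  obtain ⟨r', s', hs', h₁', h₂'⟩ := h'
  refine ⟨r * s' + r' * s, s * s', by simp [hs, hs'], ?_, ?_⟩ <;>
    simp only [map_add, map_mul, ← h₁, ← h₂, ← h₁', ← h₂'] <;> ring

theorem sub (h : SpecializesTo φ x y) (h' : SpecializesTo φ x' y') :
    SpecializesTo φ (x - x') (y - y') := by
  obtain ⟨r, s, hs, h₁, h₂⟩ := h
  obtain ⟨r', s', hs', h₁', h₂'⟩ := h'
  refine ⟨r * s' - r' * s, s * s', by simp [hs, hs'], ?_, ?_⟩ <;>
    simp only [map_sub, map_mul, ← h₁, ← h₂, ← h₁', ← h₂'] <;> ring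

theorem mul (h : SpecializesTo φ x y) (h' : SpecializesTo φ x' y') :
    SpecializesTo φ (x * x') (y * y') := by
  obtain ⟨r, s, hs, h₁, h₂⟩ := h
  obtain ⟨r', s', hs', h₁', h₂'⟩ := h'
  refine ⟨r * r', s * s', by simp [hs, hs'], ?_, ?_⟩ <;>
    simp only [map_mul, ← h₁, ← h₂, ← h₁', ← h₂'] <;> ring

theorem div [FaithfulSMul R K] (h : SpecializesTo φ x y) (h' : SpecializesTo φ x' y')
    (hy' : y' ≠ 0) : SpecializesTo φ (x / x') (y / y') := by
  obtain ⟨r, s, hs, h₁, h₂⟩ := h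
  obtain ⟨r', s', hs', h₁', h₂'⟩ := h'
  have hr' : φ r' ≠ 0 := h₂' ▸ mul_ne_zero hy' hs'
  have hx' : x' ≠ 0 := by
    rintro rfl
    rw [zero_mul, eq_comm, FaithfulSMul.algebraMap_eq_zero_iff] at h₁'
    simp [h₁'] at hr'
  refine ⟨r * s', s * r', by simp [hs, hr'], ?_, ?_⟩
  · simp only [map_mul, ← h₁, ← h₁']; field_simp
  · simp only [map_mul, ← h₂, ← h₂']; field_simp

theorem pow (h : SpecializesTo φ x y) (k : ℕ) : SpecializesTo φ (x ^ k) (y ^ k) := by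
  induction k with
  | zero => simpa using one
  | succ k ih => simpa only [pow_succ] using ih.mul h

theorem sum {ι : Type*} {s : Finset ι} {f : ι → K} {g : ι → L}
    (h : ∀ i ∈ s, SpecializesTo φ (f i) (g i)) :
    SpecializesTo φ (∑ i ∈ s, f i) (∑ i ∈ s, g i) := by
  induction s using Finset.cons_induction with
  | empty => simpa using zero
  | cons i s hi ih =>
    rw [sum_cons, sum_cons]
    exact (h i (mem_cons_self i s)).add (ih fun j hj => h j (mem_cons_of_mem hj))

theorem qPoch (h : SpecializesTo φ x y) (h' : SpecializesTo φ x' y') (k : ℕ) :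
    SpecializesTo φ (qPoch x x' k) (qPoch y y' k) := by
  induction k with
  | zero => simpa only [qPoch_zero] using one
  | succ k ih => simpa only [qPoch_succ] using ih.mul (one.sub (h.mul (h'.pow k)))

end SpecializesTo

end Specialization

section Substitution

/-- The substitution `b ↦ q ^ e` on `ℚ[a,b,c,q]`. -/
noncomputable def substB (e : ℕ) : R4 →ₐ[ℚ] R4 :=
  MvPolynomial.aeval (Function.update MvPolynomial.X 1 (MvPolynomial.X 3 ^ e))

theorem dvd_of_substB_eq_zero {e : ℕ} {f : R4} (hf : substB e f = 0) :
    (MvPolynomial.X 1 - MvPolynomial.X 3 ^ e : R4) ∣ f := by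
  rw [← Ideal.mem_span_singleton, ← Ideal.Quotient.eq_zero_iff_mem]
  set I := Ideal.span {(MvPolynomial.X 1 - MvPolynomial.X 3 ^ e : R4)} with hI
  have h : (Ideal.Quotient.mkₐ ℚ I).comp (substB e) = Ideal.Quotient.mkₐ ℚ I := by
    ext i
    by_cases hi : i = 1
    · subst hi
      simp only [substB, AlgHom.comp_apply, MvPolynomial.aeval_X, Function.update_self,
        Ideal.Quotient.mkₐ_eq_mk]
      rw [eq_comm, Ideal.Quotient.eq]
      exact Ideal.subset_span rfl
    · simp [substB, hi]
  simpa [hf] using (DFunLike.congr_fun h f).symm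

theorem substB_sub (e : ℕ) :
    substB e (MvPolynomial.X 1 - MvPolynomial.X 3 ^ e) = 0 := by
  simp [substB]

theorem prime_sub (e : ℕ) : Prime (MvPolynomial.X 1 - MvPolynomial.X 3 ^ e : R4) := by
  refine ⟨fun h => ?_, fun h => ?_, fun f g h => ?_⟩
  · have := congrArg (MvPolynomial.eval fun i : Fin 4 => if i = 1 then (2 : ℚ) else 1) h
    norm_num [show (3 : Fin 4) ≠ 1 by decide] at this
  · have := h.map (substB e)
    rw [substB_sub] at this
    exact not_isUnit_zero this
  · have := map_dvd (substB e) h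
    rw [substB_sub, zero_dvd_iff, map_mul, mul_eq_zero] at this
    exact this.imp dvd_of_substB_eq_zero dvd_of_substB_eq_zero

theorem congrK4_of_specializesTo {e : ℕ} {A B : K4} {y : K4}
    (hA : SpecializesTo ((algebraMap R4 K4).comp (substB e : R4 →+* R4)) A y)
    (hB : SpecializesTo ((algebraMap R4 K4).comp (substB e : R4 →+* R4)) B y) :
    congrK4 A B (MvPolynomial.X 1 - MvPolynomial.X 3 ^ e) := by
  obtain ⟨r, s, hs, h₁, h₂⟩ := hA.sub hB
  rw [sub_self, zero_mul, eq_comm] at h₂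
  obtain ⟨r, rfl⟩ : (MvPolynomial.X 1 - MvPolynomial.X 3 ^ e : R4) ∣ r :=
    dvd_of_substB_eq_zero (by simpa using h₂)
  have hs0 : s ≠ 0 := by rintro rfl; simp at hs
  refine ⟨r, s, hs0, ?_, ?_⟩
  · refine ((prime_sub e).irreducible.isRelPrime_iff_not_dvd.mpr fun h => hs ?_).symm
    have := map_dvd (substB e) h
    rw [substB_sub, zero_dvd_iff] at this
    simp [this]
  · rw [eq_div_iff (by simpa using hs0), h₁]

end Substitution

section Generators

theorem aK_ne_zero : aK ≠ 0 := by simp [aK]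

theorem cK_ne_zero : cK ≠ 0 := by simp [cK]

theorem qK_ne_zero : qK ≠ 0 := by simp [qK]

theorem qK_pow_ne_one {m : ℕ} (hm : m ≠ 0) : qK ^ m ≠ 1 := by
  intro h
  rw [qK, ← map_pow, ← map_one (algebraMap R4 K4),
    (FaithfulSMul.algebraMap_injective R4 K4).eq_iff] at h
  have := congrArg (MvPolynomial.eval 0) h
  simp [hm] at this

theorem cK_mul_qK_pow_ne (m k : ℕ) : cK * qK ^ m ≠ qK ^ k := by
  intro h
  rw [cK, qK, ← map_pow, ← map_pow, ← map_mul,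
    (FaithfulSMul.algebraMap_injective R4 K4).eq_iff] at h
  have := congrArg (MvPolynomial.eval (Pi.single 3 1)) h
  simp at this

end Generators

theorem mul_mod_eq_one {d n t : ℕ} (hd : 2 ≤ d) (ht : t = 1 ∨ t = d - 1) (hmod : n % d = t) :
    t * n % d = 1 := by
  have h : t * n ≡ t * t [MOD d] :=
    Nat.ModEq.mul_left t ((Nat.mod_modEq n d).symm.trans (by rw [hmod]))
  have h' : t * t ≡ 1 [MOD d] := by
    rcases ht with rfl | rfl
    · rfl
    · obtain ⟨e, rfl⟩ := Nat.exists_eq_add_of_le hd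
      rw [show 2 + e - 1 = e + 1 by omega,
        show (e + 1) * (e + 1) = 1 + (2 + e) * e by ring]
      simp [Nat.ModEq]
  have := h.trans h'
  rwa [Nat.ModEq, Nat.mod_eq_of_lt (show 1 < d by omega)] at this


theorem stmt7 (d n t : ℕ) (hd : 2 ≤ d) (hn : 0 < n) (ht : t = 1 ∨ t = d - 1)
    (hmod : n % d = t) :
    congrK4
      (∑ k ∈ Finset.range ((t * n - 1) / d + 1),
        qPoch (aK * qK) (qK ^ d) k * qPoch (qK / aK) (qK ^ d) k *
          qPoch (qK / bK) (qK ^ d) k /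
          (qPoch (qK ^ d) (qK ^ d) k * qPoch cK (qK ^ d) k *
            qPoch (qK ^ (d + 3) / (bK * cK)) (qK ^ d) k) * qK ^ (d * k))
      ((qPoch (cK / (aK * qK)) (qK ^ d) ((t * n - 1) / d) *
          qPoch (aK * cK / qK) (qK ^ d) ((t * n - 1) / d)) /
        (qPoch cK (qK ^ d) ((t * n - 1) / d) *
          qPoch (cK / qK ^ 2) (qK ^ d) ((t * n - 1) / d)))
      (MvPolynomial.X 1 - MvPolynomial.X 3 ^ (t * n)) := by
  have hmod1 := mul_mod_eq_one hd ht hmod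
  set N := (t * n - 1) / d with hN
  have he : t * n = d * N + 1 := by
    have := Nat.div_add_mod (t * n) d
    rw [hmod1] at this
    rw [hN, ← this, Nat.add_sub_cancel, Nat.mul_div_cancel_left _ (by omega)]
  rw [he]
  have ha := aK_ne_zero
  have hc := cK_ne_zero
  have hq := qK_ne_zero
  set Q := qK ^ d with hQdef
  set D := cK / qK ^ 2 with hDdef
  have hABD : aK * qK * (qK / aK) * D = cK := by rw [hDdef]; field_simp
  have hAD : aK * qK * D = aK * cK / qK := by rw [hDdef]; field_simp
  have hBD : qK / aK * D = cK / (aK * qK) := by rw [hDdef]; field_simp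
  have hQ : ∀ i, 1 - Q * Q ^ i ≠ 0 := fun i => by
    rw [← pow_succ', ← pow_mul]
    exact sub_ne_zero.mpr (qK_pow_ne_one (mul_ne_zero (by omega) i.succ_ne_zero)).symm
  have hC : ∀ i, 1 - cK * Q ^ i ≠ 0 := fun i => by
    rw [← pow_mul]
    exact sub_ne_zero.mpr (cK_mul_qK_pow_ne (d * i) 0).symm
  have hD : ∀ i, 1 - D * Q ^ i ≠ 0 := fun i h => by
    rw [hDdef, ← pow_mul, sub_eq_zero, div_mul_eq_mul_div, eq_div_iff (by positivity)] at h
    exact cK_mul_qK_pow_ne (d * i) 2 (by simpa using h.symm)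
  set e := d * N + 1 with he'
  set y := qK ^ (d + 3) / (qK ^ e * cK) with hydef
  have hY : ∀ i, 1 - y * Q ^ i ≠ 0 := fun i h => by
    rw [hydef, ← pow_mul, sub_eq_zero, div_mul_eq_mul_div, eq_div_iff (by simp [hq, hc])] at h
    exact cK_mul_qK_pow_ne e (d + 3 + d * i) (by rw [pow_add]; linear_combination h)
  have hx : qK / qK ^ e * Q ^ N = 1 := by
    rw [he', hQdef, ← pow_mul, pow_succ]
    field_simp
  have hy : y * D = qK / qK ^ e * Q := by
    rw [hydef, hDdef, hQdef]
    field_simp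
    ring
  have key := qPfaffSaalschutz (A := aK * qK) (B := qK / aK) hQ (by rwa [hABD]) hD hY hx hy
  rw [hABD, hAD, hBD] at key
  let φ : R4 →+* K4 := (algebraMap R4 K4).comp (substB e : R4 →+* R4)
  have sa : SpecializesTo φ aK aK := by
    simpa [φ, substB, aK] using SpecializesTo.algebraMap (K := K4) (φ := φ) (MvPolynomial.X 0)
  have sb : SpecializesTo φ bK (qK ^ e) := by
    simpa [φ, substB, bK, qK] using SpecializesTo.algebraMap (K := K4) (φ := φ) (MvPolynomial.X 1)
  have sc : SpecializesTo φ cK cK := by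
    simpa [φ, substB, cK] using SpecializesTo.algebraMap (K := K4) (φ := φ) (MvPolynomial.X 2)
  have sq : SpecializesTo φ qK qK := by
    simpa [φ, substB, qK] using SpecializesTo.algebraMap (K := K4) (φ := φ) (MvPolynomial.X 3)
  have sQ : SpecializesTo φ Q Q := sq.pow d
  have hC' := qPoch_ne_zero hC
  have hD' := qPoch_ne_zero hD
  apply congrK4_of_specializesTo
    (y := ∑ k ∈ range (N + 1), qPoch (aK * qK) Q k * qPoch (qK / aK) Q k *
      qPoch (qK / qK ^ e) Q k / (qPoch Q Q k * qPoch cK Q k * qPoch y Q k) * Q ^ k)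
  · refine SpecializesTo.sum fun k _ => ?_
    rw [pow_mul]
    refine .mul (.div ?_ ?_ ?_) (sQ.pow k)
    · exact (((sa.mul sq).qPoch sQ k).mul ((sq.div sa ha).qPoch sQ k)).mul
        ((sq.div sb (pow_ne_zero e hq)).qPoch sQ k)
    · exact ((sQ.qPoch sQ k).mul (sc.qPoch sQ k)).mul
        (((sq.pow _).div (sb.mul sc) (mul_ne_zero (pow_ne_zero e hq) hc)).qPoch sQ k)
    · exact mul_ne_zero (mul_ne_zero (qPoch_ne_zero hQ k) (hC' k)) (qPoch_ne_zero hY k)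
  · rw [key]
    refine .div (.mul (.qPoch ?_ sQ N) (.qPoch ?_ sQ N)) (.mul (sc.qPoch sQ N) (.qPoch ?_ sQ N))
      (mul_ne_zero (hC' N) (hD' N))
    · exact sc.div (sa.mul sq) (mul_ne_zero ha hq)
    · exact (sa.mul sc).div sq hq
    · exact sc.div (sq.pow 2) (pow_ne_zero 2 hq)
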